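/- Let U be an update sequence such that in every prefix of U, for every item e', the net frequency of e' (its number of insertions minus its number of deletions in that prefix) is nonnegative. Then after the SF_F-sketch processes U starting from all-zero subsketches, the query never underestimates: for every item e, min over i : Fin d of A i (h i e) ≥ f_U(e), where f_U(e) is the net frequency of e over all of U. (Appendix II, Theorem 3: SF_F incurs no under-estimation error.) -/

import Mathlib

/-- An update operation: insertion or deletion of an item. -/
inductive SketchOp (ι : Type) where
  | ins (e : ι)
  | del (e : ι)
deriving DecidableEq

/-- The state of the SF_F-sketch: a Slim-subsketch `A` and a Fat-subsketch `B`. -/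
structure SFFState (d w z : ℕ) where
  A : Fin d → Fin w → ℕ
  B : Fin d → Fin w → Fin z → ℕ

/-- One update step of the SF_F-sketch.

Insertion of `e`: first each counter `B i (h i e) (g i e)` is incremented by 1;
then, with `Bmin` the minimum over `i` of the updated `B i (h i e) (g i e)`,
every Slim counter `A i (h i e)` whose value equals the minimum over `i'` of
`A i' (h i' e)` and is `< Bmin` is incremented by 1; other Slim counters are
unchanged.

Deletion of `e`: each counter `B i (h i e) (g i e)` is decremented by 1; then
each Slim counter `A i (h i e)` is replaced by
`min (A i (h i e)) (max over k of the updated B i (h i e) k)`. -/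
def sffStep {ι : Type} {d w z : ℕ} [NeZero d] (h : Fin d → ι → Fin w)
    (g : Fin d → ι → Fin z) (st : SFFState d w z) : SketchOp ι → SFFState d w z
  | .ins e =>
      let B' : Fin d → Fin w → Fin z → ℕ :=
        fun i j k => if j = h i e ∧ k = g i e then st.B i j k + 1 else st.B i j k
      let Bmin := Finset.univ.inf' Finset.univ_nonempty
        (fun i => B' i (h i e) (g i e))
      let Amin := Finset.univ.inf' Finset.univ_nonempty
        (fun i' => st.A i' (h i' e))
      let A' : Fin d → Fin w → ℕ :=
        fun i j =>
          if j = h i e ∧ st.A i (h i e) = Amin ∧ st.A i (h i e) < Bmin then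
            st.A i j + 1
          else st.A i j
      ⟨A', B'⟩
  | .del e =>
      let B' : Fin d → Fin w → Fin z → ℕ :=
        fun i j k => if j = h i e ∧ k = g i e then st.B i j k - 1 else st.B i j k
      let A' : Fin d → Fin w → ℕ :=
        fun i j =>
          if j = h i e then
            min (st.A i j) (Finset.univ.sup (fun k : Fin z => B' i (h i e) k))
          else st.A i j
      ⟨A', B'⟩

/-- The state of the SF_F-sketch after processing the update sequence `U`
starting from all-zero subsketches. -/
def sffProcess {ι : Type} {d w z : ℕ} [NeZero d] (h : Fin d → ι → Fin w)
    (g : Fin d → ι → Fin z) (U : List (SketchOp ι)) : SFFState d w z :=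
  U.foldl (sffStep h g) ⟨fun _ _ => 0, fun _ _ _ => 0⟩


/-- The sketch invariant relative to a frequency function `f`. -/
def SFFInv {ι : Type} {d w z : ℕ} (h : Fin d → ι → Fin w) (g : Fin d → ι → Fin z)
    (st : SFFState d w z) (f : ι → ℕ) : Prop :=
  (∀ i j k (S : Finset ι), (∀ x ∈ S, j = h i x ∧ k = g i x) → ∑ x ∈ S, f x ≤ st.B i j k) ∧
  ∀ x i, f x ≤ st.A i (h i x)

theorem SFFInv.single {ι : Type} {d w z : ℕ} {h : Fin d → ι → Fin w} {g : Fin d → ι → Fin z}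
    {B : Fin d → Fin w → Fin z → ℕ} {f : ι → ℕ}
    (H : ∀ i j k (S : Finset ι), (∀ x ∈ S, j = h i x ∧ k = g i x) → ∑ x ∈ S, f x ≤ B i j k)
    (x : ι) (i : Fin d) : f x ≤ B i (h i x) (g i x) := by
  simpa using H i (h i x) (g i x) {x} (by simp)

theorem SFFInv.ins {ι : Type} [DecidableEq ι] {d w z : ℕ} [NeZero d]
    {h : Fin d → ι → Fin w} {g : Fin d → ι → Fin z}
    {st : SFFState d w z} {f : ι → ℕ} (H : SFFInv h g st f) (e : ι) :
    SFFInv h g (sffStep h g st (.ins e)) (fun x => f x + if x = e then 1 else 0) := by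
  obtain ⟨hB, hA⟩ := H
  refine ⟨?_, ?_⟩
  · intro i j k S hS
    have h1 := hB i j k S hS
    have h2 := hS e
    simp only [sffStep, Finset.sum_add_distrib, Finset.sum_ite_eq']
    split_ifs <;> first | omega | (exfalso; tauto)
  · intro x i
    have h1 := hA x i
    by_cases hx : x = e
    · subst hx
      simp only [sffStep, if_true, true_and, and_self]
      split_ifs with hc
      · omega
      · by_contra hlt
        have heq : st.A i (h i x) = f x := by omega
        apply hc
        refine ⟨?_, ?_⟩
        · apply le_antisymm
          · rw [heq]
            exact Finset.le_inf' _ _ (fun i' _ => hA x i')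
          · exact Finset.inf'_le (fun i' => st.A i' (h i' x)) (Finset.mem_univ i)
        · rw [Finset.lt_inf'_iff]
          intro i' _
          have := SFFInv.single hB x i'
          omega
    · simp only [sffStep, hx, if_false]
      split_ifs <;> omega

theorem SFFInv.del {ι : Type} [DecidableEq ι] {d w z : ℕ} [NeZero d]
    {h : Fin d → ι → Fin w} {g : Fin d → ι → Fin z}
    {st : SFFState d w z} {f : ι → ℕ} {e : ι}
    (H : SFFInv h g st (fun x => f x + if x = e then 1 else 0)) :
    SFFInv h g (sffStep h g st (.del e)) f := by
  obtain ⟨hB, hA⟩ := H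
  have hB' : ∀ i j k (S : Finset ι), (∀ x ∈ S, j = h i x ∧ k = g i x) →
      ∑ x ∈ S, f x ≤ (sffStep h g st (.del e)).B i j k := by
    intro i j k S hS
    simp only [sffStep]
    split_ifs with hc
    · have h1 := hB i j k (insert e S) (by simpa using ⟨hc, hS⟩)
      simp only [Finset.sum_add_distrib, Finset.sum_ite_eq', Finset.mem_insert_self,
        if_true] at h1
      have h2 : ∑ x ∈ S, f x ≤ ∑ x ∈ insert e S, f x :=
        Finset.sum_le_sum_of_subset (Finset.subset_insert e S)
      omega
    · have h1 := hB i j k S hS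
      simp only [Finset.sum_add_distrib] at h1
      omega
  refine ⟨hB', ?_⟩
  intro x i
  have h1 := hA x i
  have h2 := SFFInv.single hB' x i
  simp only [sffStep] at h2 ⊢
  simp only at h1
  by_cases hc : h i x = h i e
  · rw [if_pos hc]
    refine le_min (by omega) ?_
    rw [hc] at h2
    simp only [true_and] at h2 ⊢
    exact h2.trans (Finset.le_sup (f := fun k : Fin z =>
      if k = g i e then st.B i (h i e) k - 1 else st.B i (h i e) k)
      (Finset.mem_univ (g i x)))
  · rw [if_neg hc]
    omega

theorem SFFInv.process {ι : Type} [DecidableEq ι] {d w z : ℕ} [NeZero d]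
    (h : Fin d → ι → Fin w) (g : Fin d → ι → Fin z) (U : List (SketchOp ι)) :
    (∀ V : List (SketchOp ι), V <+: U →
      ∀ e' : ι, V.count (SketchOp.del e') ≤ V.count (SketchOp.ins e')) →
    SFFInv h g (sffProcess h g U : SFFState d w z)
      (fun x => U.count (SketchOp.ins x) - U.count (SketchOp.del x)) := by
  induction U using List.reverseRecOn with
  | nil => intro _; simp [SFFInv, sffProcess]
  | append_singleton L op ih =>
    intro hpre
    have H := ih (fun V hV => hpre V (hV.trans (List.prefix_append _ _)))
    have hL := hpre L (List.prefix_append _ _)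
    have hT := hpre _ (List.prefix_refl _)
    have hs : (sffProcess h g (L ++ [op]) : SFFState d w z)
        = sffStep h g (sffProcess h g L) op := by simp [sffProcess]
    rw [hs]
    cases op with
    | ins e =>
      convert H.ins e using 2 with x
      have := hL x
      by_cases hx : x = e
      · subst hx
        simp
        omega
      · have hx' : ¬ e = x := fun q => hx q.symm
        simp [hx, hx']
    | del e =>
      apply SFFInv.del
      convert H using 2 with x
      have := hT x
      by_cases hx : x = e
      · subst hx
        simp at this ⊢
        omega
      · have hx' : ¬ e = x := fun q => hx q.symm
        simp [hx, hx']

/-- Appendix II, Theorem 3: if in every prefix of the update sequence `U` every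
item has nonnegative net frequency (its number of deletions never exceeds its
number of insertions), then after processing `U` the SF_F-sketch query never
underestimates: for every item `e`, the minimum over `i` of `A i (h i e)` is at
least the net frequency of `e` over all of `U`. -/
theorem sff_no_underestimation {ι : Type} [DecidableEq ι] {d w z : ℕ}
    [NeZero d] [NeZero w] [NeZero z]
    (h : Fin d → ι → Fin w) (g : Fin d → ι → Fin z) (U : List (SketchOp ι))
    (hpre : ∀ V : List (SketchOp ι), V <+: U →
      ∀ e' : ι, V.count (SketchOp.del e') ≤ V.count (SketchOp.ins e')) :
    ∀ e : ι,
      U.count (SketchOp.ins e) - U.count (SketchOp.del e)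
        ≤ Finset.univ.inf' Finset.univ_nonempty
            (fun i : Fin d => (sffProcess h g U : SFFState d w z).A i (h i e)) := by
  intro e
  exact Finset.le_inf' _ _ (fun i _ => (SFFInv.process h g U hpre).2 e i)
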